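/- Let φ_σ ∈ 𝒦 with parameter σ > 0, let ω > 0, let z ∈ ℬ_ω be a generating bar code, set f_σ = φ_σ * z, and let λ > 0. Then u ≡ 0 is the unique minimiser of F₂(u) = ∫_ℝ |u′| + λ‖φ_σ*u − f_σ‖²_{L²(ℝ)} over BV(ℝ) (with F₂(u) := ∞ when φ_σ*u ∉ L²(ℝ); uniqueness meaning F₂(0) < F₂(h) for every h ∈ BV(ℝ) with h ≠ 0 a.e.) if and only if ‖φ_σ*f_σ‖_* ≤ 1/(2λ). -/

import Mathlib

open MeasureTheory Set

noncomputable section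

/-- The total variation `∫_ℝ |u'|` of a function `u : ℝ → ℝ`. -/
def TV (u : ℝ → ℝ) : ENNReal := eVariationOn u Set.univ

/-- Convolution `(φ * u)(x) = ∫_ℝ φ(x − y) u(y) dy`. -/
def conv (φ u : ℝ → ℝ) : ℝ → ℝ := fun x => ∫ y : ℝ, φ (x - y) * u y

/-- Membership of `φ` in the kernel class `𝒦`, with parameter `σ` and profile `p`:
`φ(x) = p(|x|) χ_{[−σ,σ]}(x)` with `p ≥ 0` monotonically decreasing on `[0,σ]`
and `∫₀^σ p = 1/2`; in particular `φ ∈ L¹(ℝ)`. -/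
def IsKernelWith (φ : ℝ → ℝ) (p : ℝ → ℝ) (σ : ℝ) : Prop :=
  0 < σ ∧ Integrable φ ∧
    (∀ x ∈ Icc (0:ℝ) σ, 0 ≤ p x) ∧ AntitoneOn p (Icc (0:ℝ) σ) ∧
    (∫ x in (0:ℝ)..σ, p x) = 1 / 2 ∧
    ∀ x : ℝ, φ x = if |x| ≤ σ then p |x| else 0

/-- The hat kernel `φ̂_σ(x) = (1 − |x|/σ)/σ` for `|x| < σ`, `0` otherwise. -/
def hatKernel (σ : ℝ) : ℝ → ℝ := fun x => if |x| < σ then (1 - |x| / σ) / σ else 0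

/-- The dual norm `‖f‖_* = sup { |∫ f v| : v ∈ L¹(ℝ), ∫_ℝ |v'| ≤ 1 }`. -/
def starNorm (f : ℝ → ℝ) : ENNReal :=
  ⨆ (v : ℝ → ℝ) (_ : Integrable v ∧ TV v ≤ 1), ENNReal.ofReal |∫ x : ℝ, f x * v x|

/-- Structural description of a bar code: `n` bars with interface points
`t 0 < t 1 < ⋯ < t (2n−1)` inside `[0,1]`; the bars are the intervals
`[t (2k), t (2k+1)]`, `k < n`. -/
structure BarcodeRep where
  n : ℕ
  t : ℕ → ℝ
  mono : StrictMonoOn t (Set.Iio (2 * n))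
  left : n ≠ 0 → 0 ≤ t 0
  right : n ≠ 0 → t (2 * n - 1) ≤ 1

/-- The support of a bar code: the union of its (closed) bars. -/
def BarcodeRep.supp (B : BarcodeRep) : Set ℝ :=
  ⋃ k ∈ Finset.range B.n, Icc (B.t (2 * k)) (B.t (2 * k + 1))

/-- The bar code as a function: the characteristic function of the union of its bars. -/
def BarcodeRep.fn (B : BarcodeRep) : ℝ → ℝ := B.supp.indicator fun _ => (1:ℝ)

/-- `x` is an interface location (an endpoint of a bar) of the bar code `B`. -/
def BarcodeRep.IsInterface (B : BarcodeRep) (x : ℝ) : Prop := ∃ k < 2 * B.n, B.t k = x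

/-- All bars and all (maximal, nonempty) spaces in `[0,1]` of the bar code `B`
have width at least `ω`. -/
def BarcodeRep.MinWidth (B : BarcodeRep) (ω : ℝ) : Prop :=
  (∀ k < B.n, ω ≤ B.t (2 * k + 1) - B.t (2 * k)) ∧
  (∀ k, k + 1 < B.n → ω ≤ B.t (2 * k + 2) - B.t (2 * k + 1)) ∧
  (B.n ≠ 0 → 0 < B.t 0 → ω ≤ B.t 0) ∧
  (B.n ≠ 0 → B.t (2 * B.n - 1) < 1 → ω ≤ 1 - B.t (2 * B.n - 1))

/-- Membership in `ℬ`: `u` is (the standard representative of) a bar code. -/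
def IsBarcode (u : ℝ → ℝ) : Prop := ∃ B : BarcodeRep, u = B.fn

/-- Membership in `ℬ_ω`. -/
def IsBarcodeW (u : ℝ → ℝ) (ω : ℝ) : Prop := ∃ B : BarcodeRep, u = B.fn ∧ B.MinWidth ω

/-- Membership in `ℬ^{ij}`: `u = i` on `[0,x₁]` and `u = j` on `[x₂,1]` for some
`0 < x₁ ≤ x₂ < 1`. -/
def InBij (u : ℝ → ℝ) (i j : ℝ) : Prop :=
  ∃ x₁ x₂ : ℝ, 0 < x₁ ∧ x₁ ≤ x₂ ∧ x₂ < 1 ∧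
    (∀ x ∈ Icc (0:ℝ) x₁, u x = i) ∧ (∀ x ∈ Icc x₂ (1:ℝ), u x = j)

/-- The `L²` fidelity term `‖g − f‖²_{L²(ℝ)}`, valued in `[0,∞]`
(equal to `∞` if `g − f ∉ L²(ℝ)`). -/
def fidelity (g f : ℝ → ℝ) : ENNReal := ∫⁻ x : ℝ, ENNReal.ofReal ((g x - f x) ^ 2)

/-- The functional `F₁(u) = ∫_ℝ |u'| + λ ‖u − f‖²_{L²(ℝ)}`. -/
def F1 (lam : ℝ) (f u : ℝ → ℝ) : ENNReal := TV u + ENNReal.ofReal lam * fidelity u f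

/-- The (blind) deconvolution functional `F(u) = ∫_ℝ |u'| + λ ‖φ*u − f‖²_{L²(ℝ)}`
(this is `F₂` when `φ = φ_σ` and `F₃` when `φ = φ_ρ`). -/
def Fker (lam : ℝ) (φ f u : ℝ → ℝ) : ENNReal :=
  TV u + ENNReal.ofReal lam * fidelity (conv φ u) f

open Filter Topology

lemma TV_bound {h : ℝ → ℝ} (hT : TV h < ⊤) : ∃ M, ∀ x, |h x| ≤ M := by
  have hb : BoundedVariationOn h univ := hT.ne
  refine ⟨|h 0| + (eVariationOn h univ).toReal, fun x => ?_⟩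
  have := hb.dist_le (mem_univ x) (mem_univ 0)
  rw [Real.dist_eq] at this
  have h2 := abs_sub_abs_le_abs_sub (h x) (h 0)
  linarith

lemma TV_measurable {h : ℝ → ℝ} (hT : TV h < ⊤) : Measurable h := by
  have hb : BoundedVariationOn h univ := hT.ne
  obtain ⟨p, q, hp, hq, rfl⟩ := hb.locallyBoundedVariationOn.exists_monotoneOn_sub_monotoneOn
  exact (monotoneOn_univ.1 hp).measurable.sub (monotoneOn_univ.1 hq).measurable

lemma TV_const_mul (c : ℝ) (h : ℝ → ℝ) : TV (fun x => c * h x) ≤ ENNReal.ofReal |c| * TV h := by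
  have hl : LipschitzWith (Real.toNNReal |c|) (fun y : ℝ => c * y) := by
    apply LipschitzWith.of_dist_le_mul
    intro x y
    rw [Real.dist_eq, Real.dist_eq, ← mul_sub, abs_mul]
    simp
  have := (hl.lipschitzOnWith (s := univ)).comp_eVariationOn_le (g := h) (s := univ)
    (fun _ _ => mem_univ _)
  exact this

lemma TV_trunc (h : ℝ → ℝ) {a b : ℝ} (hab : a ≤ b) :
    TV ((Icc a b).indicator h) ≤ TV h + ENNReal.ofReal |h a| + ENNReal.ofReal |h b| := by
  set w := (Icc a b).indicator h with hw
  let ψ : ℝ → ℝ := fun x => if x < a then a - 1 else if x ≤ b then x else b + 1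
  have hψ : MonotoneOn ψ univ := by
    intro x _ y _ hxy
    simp only [ψ]
    split_ifs <;> linarith
  have hwψ : w = w ∘ ψ := by
    funext x
    simp only [hw, ψ, Function.comp, indicator, mem_Icc]
    grind
  have h1 : TV w ≤ eVariationOn w (({a - 1} ∪ Icc a b) ∪ {b + 1}) := by
    have := eVariationOn.comp_le_of_monotoneOn w (s := ({a - 1} ∪ Icc a b) ∪ {b + 1}) ψ hψ (by
      intro x _
      simp only [ψ, mem_union, mem_singleton_iff, mem_Icc]
      grind)
    rwa [← hwψ] at this
  have hg : IsGreatest ({a - 1} ∪ Icc a b) b := by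
    constructor
    · simp [hab]
    · rintro x (hx | hx)
      · rw [mem_singleton_iff] at hx; linarith
      · exact hx.2
  rw [eVariationOn.union' w hg (isLeast_singleton (a := b + 1)) (by linarith),
    eVariationOn.union' w (isGreatest_singleton (a := a - 1)) (isLeast_Icc hab) (by linarith)] at h1
  have e1 : w (a - 1) = 0 := by simp [hw]
  have e2 : w a = h a := by simp [hw, hab]
  have e3 : w b = h b := by simp [hw, hab]
  have e4 : w (b + 1) = 0 := by simp [hw]
  have e5 : eVariationOn w (Icc a b) ≤ TV h := by
    rw [eVariationOn.congr (g := h) (fun x hx => by simp [hw, hx])]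
    exact eVariationOn.mono h (subset_univ _)
  rw [e1, e2, e3, e4, eVariationOn.subsingleton _ subsingleton_singleton,
    eVariationOn.subsingleton _ subsingleton_singleton, edist_dist, edist_dist, dist_zero_left,
    dist_zero_right, Real.norm_eq_abs, Real.norm_eq_abs] at h1
  refine h1.trans ?_
  rw [zero_add, add_zero, add_comm (ENNReal.ofReal |h a|)]
  gcongr

/-- Basic facts about the kernel. -/
structure Ker (φ : ℝ → ℝ) (σ : ℝ) : Prop where
  int : Integrable φ
  even : ∀ x, φ (-x) = φ x
  one : ∫ x, φ x = 1
  zero : ∀ x, σ < |x| → φ x = 0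
  pos : 0 < σ

lemma IsKernelWith.ker {φ p : ℝ → ℝ} {σ : ℝ} (h : IsKernelWith φ p σ) : Ker φ σ := by
  obtain ⟨h0, h1, h2, h3, h4, h5⟩ := h
  refine ⟨h1, fun x => by rw [h5, h5, abs_neg], ?_, fun x hx => by rw [h5, if_neg (by linarith)], h0⟩
  have e : φ = fun x => (fun y => if y ≤ σ then p y else 0) |x| := by
    funext x; rw [h5]
  rw [e, integral_comp_abs, ← Ioc_union_Ioi_eq_Ioi h0.le]
  have : (fun y => if y ≤ σ then p y else 0) = (Iic σ).indicator p := by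
    funext y; simp [indicator]
  rw [this, setIntegral_indicator measurableSet_Iic, Ioc_union_Ioi_eq_Ioi h0.le, Ioi_inter_Iic,
    ← intervalIntegral.integral_of_le h0.le, h4]
  norm_num

lemma conv_bound {φ u : ℝ → ℝ} {M : ℝ} (hφ : Integrable φ) (hu : ∀ x, |u x| ≤ M) (x : ℝ) :
    |conv φ u x| ≤ (∫ y, |φ y|) * M := by
  unfold conv
  rw [← integral_sub_left_eq_self (fun y => |φ y|) volume x, ← integral_mul_const,
    ← Real.norm_eq_abs]
  refine norm_integral_le_of_norm_le ((hφ.abs.comp_sub_left x).mul_const M) (ae_of_all _ fun y => ?_)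
  rw [norm_mul, Real.norm_eq_abs, Real.norm_eq_abs]
  exact mul_le_mul_of_nonneg_left (hu y) (abs_nonneg _)

lemma conv_aesm {φ u : ℝ → ℝ} (hφ : Integrable φ) (hu : AEStronglyMeasurable u volume) :
    AEStronglyMeasurable (conv φ u) volume := by
  have := (hu.convolution_integrand (μ := volume) (ContinuousLinearMap.mul ℝ ℝ) hφ.1).integral_prod_right'
  refine this.congr (ae_of_all _ fun x => ?_)
  simp [conv, mul_comm]

lemma conv_int {φ u : ℝ → ℝ} (hφ : Integrable φ) (hu : Integrable u) : Integrable (conv φ u) := by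
  have := hu.integrable_convolution (ContinuousLinearMap.mul ℝ ℝ) hφ
  refine this.congr (ae_of_all _ fun x => ?_)
  simp [conv, convolution, mul_comm]

lemma conv_supp {φ u : ℝ → ℝ} {σ A B : ℝ} (hφ : Ker φ σ) (hu : ∀ x, x ∉ Icc A B → u x = 0) :
    ∀ x, x ∉ Icc (A - σ) (B + σ) → conv φ u x = 0 := by
  intro x hx
  unfold conv
  rw [← integral_zero ℝ ℝ (μ := volume)]
  congr 1
  funext y
  by_cases hy : y ∈ Icc A B
  · rw [hφ.zero, zero_mul]
    simp only [mem_Icc, not_and_or, not_le] at hx hy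
    rw [lt_abs]
    rcases hx with hx | hx
    · right; linarith [hy.1]
    · left; linarith [hy.2]
  · rw [hu y hy, mul_zero]

lemma conv_smul (φ u : ℝ → ℝ) (c : ℝ) : conv φ (fun x => c * u x) = fun x => c * conv φ u x := by
  funext x
  simp only [conv]
  rw [← integral_const_mul]
  congr 1; funext y; ring

lemma conv_adj {φ u f : ℝ → ℝ} {σ M : ℝ} (hφ : Ker φ σ) (hf : Integrable f)
    (hu : AEStronglyMeasurable u volume) (hM : ∀ x, |u x| ≤ M) :
    ∫ x, conv φ u x * f x = ∫ x, conv φ f x * u x := by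
  have hi := hf.convolution_integrand (μ := volume) (ContinuousLinearMap.mul ℝ ℝ) hφ.int
  have hi2 : Integrable (fun q : ℝ × ℝ => u q.1 * (f q.2 * φ (q.1 - q.2))) (volume.prod volume) := by
    refine hi.bdd_mul (c := M) hu.comp_fst (ae_of_all _ fun q => hM _)
  have := integral_integral_swap (f := fun x y => u x * (f y * φ (x - y))) hi2
  calc ∫ x, conv φ u x * f x = ∫ y, ∫ x, u x * (f y * φ (x - y)) := by
        congr 1; funext y
        rw [conv, ← integral_mul_const]
        congr 1; funext x
        rw [← hφ.even (x - y), neg_sub]; ring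
    _ = ∫ x, ∫ y, u x * (f y * φ (x - y)) := this.symm
    _ = _ := by
        congr 1; funext x
        rw [conv, ← integral_mul_const]
        congr 1; funext y; ring

lemma memLp_two {k : ℝ → ℝ} {M : ℝ} (hk : Integrable k) (hM : ∀ x, |k x| ≤ M) :
    MemLp k 2 volume := by
  rw [memLp_two_iff_integrable_sq hk.1]
  have := hk.bdd_mul (c := M) hk.1 (ae_of_all _ fun q => hM _)
  simpa [sq] using this

lemma integral_sq_sub {k f : ℝ → ℝ} (hk : MemLp k 2 volume) (hf : MemLp f 2 volume) :
    ∫ x, (k x - f x) ^ 2 = (∫ x, k x ^ 2) - 2 * (∫ x, k x * f x) + ∫ x, f x ^ 2 := by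
  have h1 := hk.integrable_sq
  have h2 := hf.integrable_sq
  have h3 : Integrable (fun x => k x * f x) := hk.integrable_mul hf
  have h5 : Integrable (fun x => k x ^ 2 - 2 * (k x * f x)) := h1.sub (h3.const_mul 2)
  rw [← integral_const_mul, ← integral_sub h1 (h3.const_mul 2), ← integral_add h5 h2]
  congr 1; funext x; ring

lemma fidelity_eq {k f : ℝ → ℝ} (hk : MemLp k 2 volume) (hf : MemLp f 2 volume) :
    fidelity k f = ENNReal.ofReal ((∫ x, k x ^ 2) - 2 * (∫ x, k x * f x) + ∫ x, f x ^ 2) := by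
  have h4 := (hk.sub hf).integrable_sq
  simp only [Pi.sub_apply] at h4
  rw [fidelity, ← ofReal_integral_eq_lintegral_ofReal h4 (ae_of_all _ fun x => sq_nonneg _)]
  rw [integral_sq_sub hk hf]

lemma fidelity_memLp {k f : ℝ → ℝ} (hk : AEStronglyMeasurable k volume) (hf : MemLp f 2 volume)
    (h : fidelity k f ≠ ⊤) : MemLp k 2 volume := by
  have : MemLp (k - f) 2 volume := by
    rw [memLp_two_iff_integrable_sq (hk.sub hf.1)]
    refine ⟨(hk.sub hf.1).pow 2, ?_⟩
    rw [hasFiniteIntegral_iff_ofReal (ae_of_all _ fun x => sq_nonneg _)]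
    exact lt_top_iff_ne_top.2 h
  simpa using this.add hf

lemma conv_tendsto {φ u : ℝ → ℝ} {σ M c : ℝ} (hφ : Ker φ σ) {l : Filter ℝ} [l.IsCountablyGenerated]
    (hu : Measurable u) (hM : ∀ x, |u x| ≤ M) (hl : ∀ y, Tendsto (fun x => x - y) l l)
    (hc : Tendsto u l (𝓝 c)) : Tendsto (conv φ u) l (𝓝 c) := by
  have e : conv φ u = fun x => ∫ y, φ y * u (x - y) := by
    funext x
    rw [conv, ← integral_sub_left_eq_self _ volume x]
    simp
  rw [e]
  have : c = ∫ y, φ y * c := by rw [integral_mul_const, hφ.one, one_mul]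
  rw [this]
  refine tendsto_integral_filter_of_dominated_convergence (fun y => |φ y| * M) ?_ ?_
    (hφ.int.abs.mul_const M) ?_
  · exact Eventually.of_forall fun x => hφ.int.1.mul
      (hu.comp (measurable_const.sub measurable_id)).aestronglyMeasurable
  · refine Eventually.of_forall fun x => ae_of_all _ fun y => ?_
    rw [norm_mul, Real.norm_eq_abs, Real.norm_eq_abs]
    exact mul_le_mul_of_nonneg_left (hM _) (abs_nonneg _)
  · exact ae_of_all _ fun y => (hc.comp (hl y)).const_mul _

lemma limit_zero {k : ℝ → ℝ} {c : ℝ} {l : Filter ℝ} (hk : MemLp k 2 volume)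
    (hl : ∀ s ∈ l, volume s = ⊤) (hc : Tendsto k l (𝓝 c)) : c = 0 := by
  have h : IntegrableAtFilter (fun x => k x ^ 2) l volume :=
    ⟨univ, univ_mem, hk.integrable_sq.integrableOn⟩
  have := h.eq_zero_of_tendsto hl (hc.pow 2)
  simpa using this

lemma lims_zero {φ h : ℝ → ℝ} {σ : ℝ} (hφ : Ker φ σ) (hT : TV h < ⊤)
    (hk : MemLp (conv φ h) 2 volume) : Tendsto h atTop (𝓝 0) ∧ Tendsto h atBot (𝓝 0) := by
  have hb : BoundedVariationOn h univ := hT.ne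
  obtain ⟨M, hM⟩ := TV_bound hT
  constructor
  · obtain ⟨c, hc⟩ := hb.exists_tendsto_atTop
    rw [principal_univ, top_inf_eq] at hc
    have h1 := conv_tendsto hφ (TV_measurable hT) hM
      (fun y => by simpa [sub_eq_add_neg] using tendsto_atTop_add_const_right atTop (-y) tendsto_id) hc
    have h2 := limit_zero hk (fun s hs => by
      rcases mem_atTop_sets.1 hs with ⟨b, hb⟩
      rw [← top_le_iff, ← Real.volume_Ici (a := b)]
      exact measure_mono hb) h1
    rwa [h2] at hc
  · obtain ⟨c, hc⟩ := hb.exists_tendsto_atBot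
    rw [principal_univ, top_inf_eq] at hc
    have h1 := conv_tendsto hφ (TV_measurable hT) hM
      (fun y => by simpa [sub_eq_add_neg] using tendsto_atBot_add_const_right atBot (-y) tendsto_id) hc
    have h2 := limit_zero hk (fun s hs => by
      rcases mem_atBot_sets.1 hs with ⟨b, hb⟩
      rw [← top_le_iff, ← Real.volume_Iic (a := b)]
      exact measure_mono hb) h1
    rwa [h2] at hc

lemma barcode_facts {z : ℝ → ℝ} {ω : ℝ} (hz : IsBarcodeW z ω) :
    Measurable z ∧ (∀ x, |z x| ≤ 1) ∧ ∀ x, x ∉ Icc (0:ℝ) 1 → z x = 0 := by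
  obtain ⟨B, rfl, -⟩ := hz
  refine ⟨?_, fun x => ?_, fun x hx => ?_⟩
  · refine measurable_const.indicator ?_
    exact Finset.measurableSet_biUnion _ fun k _ => measurableSet_Icc
  · unfold BarcodeRep.fn
    by_cases h : x ∈ B.supp <;> simp [h]
  · unfold BarcodeRep.fn
    refine indicator_of_notMem (fun hxs => hx ?_) _
    simp only [BarcodeRep.supp, mem_iUnion, Finset.mem_range] at hxs
    obtain ⟨k, hk, h1, h2⟩ := hxs
    have hn : B.n ≠ 0 := by omega
    have m := B.mono.monotoneOn
    have a1 : B.t 0 ≤ B.t (2 * k) := m (mem_Iio.2 (by omega)) (mem_Iio.2 (by omega)) (by omega)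
    have a2 : B.t (2 * k + 1) ≤ B.t (2 * B.n - 1) :=
      m (mem_Iio.2 (by omega)) (mem_Iio.2 (by omega)) (by omega)
    exact ⟨by linarith [B.left hn], by linarith [B.right hn]⟩

lemma starNorm_apply {g : ℝ → ℝ} {lam T : ℝ} (hlam : 0 < lam) (hT : 0 < T)
    (hs : starNorm g ≤ ENNReal.ofReal (1 / (2 * lam))) {w : ℝ → ℝ} (hw : Integrable w)
    (hTV : TV w ≤ ENNReal.ofReal T) : 2 * lam * |∫ x, g x * w x| ≤ T := by
  have h1 : TV (fun x => T⁻¹ * w x) ≤ 1 := by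
    refine (TV_const_mul _ _).trans ?_
    refine (mul_le_mul_right hTV _).trans ?_
    rw [← ENNReal.ofReal_mul (abs_nonneg _), abs_of_pos (inv_pos.2 hT), inv_mul_cancel₀ hT.ne']
    simp
  rw [starNorm, iSup₂_le_iff] at hs
  have h2 := hs (fun x => T⁻¹ * w x) ⟨hw.const_mul _, h1⟩
  rw [ENNReal.ofReal_le_ofReal_iff (by positivity)] at h2
  have e : ∫ x, g x * (T⁻¹ * w x) = T⁻¹ * ∫ x, g x * w x := by
    rw [← integral_const_mul]; congr 1; funext x; ring
  rw [e, abs_mul, abs_of_pos (inv_pos.2 hT)] at h2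
  field_simp at h2
  linarith

/-- Corollary 1, part 1: for `φ_σ ∈ 𝒦`, `z ∈ ℬ_ω`,
`f_σ = φ_σ * z` and `λ > 0`, the zero function is the unique minimiser of `F₂`
over `BV(ℝ)` if and only if `‖φ_σ * f_σ‖_* ≤ 1/(2λ)`. -/
theorem statement4 (φ p : ℝ → ℝ) (σ ω lam : ℝ) (hφ : IsKernelWith φ p σ) (hω : 0 < ω)
    (z : ℝ → ℝ) (hz : IsBarcodeW z ω) (hlam : 0 < lam) :
    (∀ h : ℝ → ℝ, TV h < ⊤ → ¬ h =ᵐ[volume] (fun _ => (0:ℝ)) →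
        Fker lam φ (conv φ z) (fun _ => (0:ℝ)) < Fker lam φ (conv φ z) h) ↔
      starNorm (conv φ (conv φ z)) ≤ ENNReal.ofReal (1 / (2 * lam)) := by
  have hK := hφ.ker
  obtain ⟨zm, zb, zs⟩ := barcode_facts hz
  have zi : Integrable z := by
    have : Integrable ((Icc (0:ℝ) 1).indicator fun _ => (1:ℝ)) :=
      (integrable_indicator_iff measurableSet_Icc).2 (by simp)
    refine this.mono zm.aestronglyMeasurable (ae_of_all _ fun x => ?_)
    by_cases hx : x ∈ Icc (0:ℝ) 1
    · simpa [indicator_of_mem hx] using zb x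
    · simp [zs x hx]
  set f := conv φ z with hf
  have fb := conv_bound hK.int zb
  have fi : Integrable f := conv_int hK.int zi
  have f2 : MemLp f 2 volume := memLp_two fi fb
  have gs := conv_supp hK (conv_supp hK zs)
  rw [← hf] at gs fb
  set g := conv φ f with hg
  have gi : Integrable g := conv_int hK.int fi
  set A := ∫ x, f x ^ 2 with hA
  have hA0 : 0 ≤ A := integral_nonneg fun x => sq_nonneg _
  have F0 : Fker lam φ f (fun _ => (0:ℝ)) = ENNReal.ofReal (lam * A) := by
    have e1 : TV (fun _ : ℝ => (0:ℝ)) = 0 := by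
      apply eVariationOn.constant_on
      rintro _ ⟨_, _, rfl⟩ _ ⟨_, _, rfl⟩; rfl
    have e2 : conv φ (fun _ => (0:ℝ)) = fun _ => 0 := by funext x; simp [conv]
    rw [Fker, e1, e2, fidelity_eq (by simp) f2, ENNReal.ofReal_mul hlam.le]
    simp [hA]
  have FV : ∀ h, TV h < ⊤ → MemLp (conv φ h) 2 volume → Fker lam φ f h = ENNReal.ofReal
      ((TV h).toReal + lam * ((∫ x, conv φ h x ^ 2) - 2 * (∫ x, g x * h x) + A)) := by
    intro h hT hk
    obtain ⟨M, hM⟩ := TV_bound hT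
    have hadj := conv_adj hK fi (TV_measurable hT).aestronglyMeasurable hM
    have hnn : 0 ≤ (∫ x, conv φ h x ^ 2) - 2 * (∫ x, g x * h x) + A := by
      rw [hg, ← hadj, hA, ← integral_sq_sub hk f2]
      exact integral_nonneg fun x => sq_nonneg _
    rw [Fker, fidelity_eq hk f2, hadj, ENNReal.ofReal_add ENNReal.toReal_nonneg
      (mul_nonneg hlam.le hnn), ENNReal.ofReal_toReal hT.ne, ENNReal.ofReal_mul hlam.le]
  rw [F0]
  constructor
  · intro H
    refine iSup₂_le fun v hv => ?_
    obtain ⟨vi, vT⟩ := hv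
    have vT' : TV v < ⊤ := vT.trans_lt ENNReal.one_lt_top
    obtain ⟨M, hM⟩ := TV_bound vT'
    by_cases hv0 : v =ᵐ[volume] (fun _ => (0:ℝ))
    · have : ∫ x, g x * v x = 0 := by
        rw [← integral_zero ℝ ℝ (μ := volume)]
        refine integral_congr_ae ?_
        filter_upwards [hv0] with x hx
        rw [hx, mul_zero]
      simp [this]
    have k2 : MemLp (conv φ v) 2 volume := memLp_two (conv_int hK.int vi) (conv_bound hK.int hM)
    set Q := ∫ x, conv φ v x ^ 2 with hQ
    set P := ∫ x, g x * v x with hP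
    have key : ∀ c : ℝ, c ≠ 0 → 0 < |c| + lam * (c ^ 2 * Q - 2 * (c * P)) := by
      intro c hc
      have hT : TV (fun x => c * v x) ≤ ENNReal.ofReal |c| :=
        (TV_const_mul c v).trans ((mul_le_mul_right vT _).trans (by simp))
      have hT' := hT.trans_lt ENNReal.ofReal_lt_top
      have h1 := H (fun x => c * v x) hT' (fun h0 => hv0 (by
        filter_upwards [h0] with x hx
        simpa [hc] using hx))
      have hcv := conv_smul φ v c
      rw [FV _ hT' (by rw [hcv]; exact k2.const_mul c),
        ENNReal.ofReal_lt_ofReal_iff_of_nonneg (mul_nonneg hlam.le hA0), hcv] at h1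
      have e1 : ∫ x, (c * conv φ v x) ^ 2 = c ^ 2 * Q := by
        rw [hQ, ← integral_const_mul]; congr 1; funext x; ring
      have e2 : ∫ x, g x * (c * v x) = c * P := by
        rw [hP, ← integral_const_mul]; congr 1; funext x; ring
      rw [e1, e2] at h1
      have h3 : (TV fun x => c * v x).toReal ≤ |c| := by
        have := ENNReal.toReal_mono ENNReal.ofReal_ne_top hT
        rwa [ENNReal.toReal_ofReal (abs_nonneg _)] at this
      linarith
    have key2 : ∀ ε : ℝ, 0 < ε → 2 * lam * |P| ≤ 1 + ε * (lam * Q) := by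
      intro ε hε
      have h1 := key ε hε.ne'
      have h2 := key (-ε) (by linarith)
      rw [abs_neg] at h2
      rw [abs_of_pos hε] at h1 h2
      have h1' : 0 < ε * (1 + ε * (lam * Q) - 2 * lam * P) := by linarith
      have h2' : 0 < ε * (1 + ε * (lam * Q) + 2 * lam * P) := by linarith
      have h1'' := pos_of_mul_pos_right h1' hε.le
      have h2'' := pos_of_mul_pos_right h2' hε.le
      rcases abs_cases P with ⟨h, _⟩ | ⟨h, _⟩ <;> rw [h] <;> linarith
    have key3 : 2 * lam * |P| ≤ 1 := by
      have ht : Tendsto (fun ε : ℝ => 1 + ε * (lam * Q)) (𝓝[>] 0) (𝓝 1) := by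
        have : Tendsto (fun ε : ℝ => 1 + ε * (lam * Q)) (𝓝 0) (𝓝 (1 + 0 * (lam * Q))) :=
          (by fun_prop : Continuous (fun ε : ℝ => 1 + ε * (lam * Q))).tendsto 0
        rw [zero_mul, add_zero] at this
        exact this.mono_left nhdsWithin_le_nhds
      exact ge_of_tendsto ht (eventually_nhdsWithin_of_forall key2)
    apply ENNReal.ofReal_le_ofReal
    rw [le_div_iff₀ (by positivity)]
    linarith
  · intro hs h hT hh0
    by_cases hfin : fidelity (conv φ h) f = ⊤
    · rw [Fker, hfin, ENNReal.mul_top (by simpa using hlam), add_top]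
      exact ENNReal.ofReal_lt_top
    have hm := TV_measurable hT
    obtain ⟨M, hM⟩ := TV_bound hT
    have k2 := fidelity_memLp (conv_aesm hK.int hm.aestronglyMeasurable) f2 hfin
    obtain ⟨hl1, hl2⟩ := lims_zero hK hT k2
    rw [FV h hT k2, ENNReal.ofReal_lt_ofReal_iff_of_nonneg (mul_nonneg hlam.le hA0)]
    set Q := ∫ x, conv φ h x ^ 2 with hQ
    set P := ∫ x, g x * h x with hP
    have hQ0 : 0 ≤ Q := integral_nonneg fun x => sq_nonneg _
    have hadj := conv_adj hK fi hm.aestronglyMeasurable hM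
    rw [← hg, ← hP] at hadj
    have hTpos : 0 < (TV h).toReal := by
      refine ENNReal.toReal_pos (fun h0 => hh0 ?_) hT.ne
      have hc := (eVariationOn.eq_zero_iff h).1 h0
      have hc' : h = fun _ => h 0 := by
        funext x; exact edist_eq_zero.1 (hc x (mem_univ _) 0 (mem_univ _))
      have h00 : h 0 = 0 := by
        rw [hc'] at hl1
        exact tendsto_nhds_unique tendsto_const_nhds hl1
      rw [hc', h00]
    have key : 2 * lam * |P| ≤ (TV h).toReal := by
      refine le_of_forall_pos_le_add fun ε hε => ?_
      obtain ⟨b, hb1, hb2⟩ := (((tendsto_order.1 hl1.abs).2 (ε / 2) (by simpa using hε)).and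
        (eventually_ge_atTop (1 + σ + σ))).exists
      obtain ⟨a, ha1, ha2⟩ := (((tendsto_order.1 hl2.abs).2 (ε / 2) (by simpa using hε)).and
        (eventually_le_atBot (0 - σ - σ))).exists
      have hσ := hK.pos
      have hab : a ≤ b := by linarith
      have hw : Integrable ((Icc a b).indicator h) := by
        rw [integrable_indicator_iff measurableSet_Icc]
        refine Measure.integrableOn_of_bounded (M := M) (by simp) hm.aestronglyMeasurable
          (ae_of_all _ fun x => hM x)
      have hTw : TV ((Icc a b).indicator h) ≤ ENNReal.ofReal ((TV h).toReal + ε) := by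
        refine (TV_trunc h hab).trans ?_
        rw [← ENNReal.ofReal_toReal hT.ne, ← ENNReal.ofReal_add (by positivity) (by positivity),
          ← ENNReal.ofReal_add (by positivity) (by positivity)]
        apply ENNReal.ofReal_le_ofReal
        rw [ENNReal.toReal_ofReal (by positivity)]
        linarith
      have h1 := starNorm_apply hlam (by positivity) hs hw hTw
      have e : ∫ x, g x * (Icc a b).indicator h x = P := by
        rw [hP]; congr 1; funext x
        by_cases hx : x ∈ Icc a b
        · rw [indicator_of_mem hx]
        · rw [gs x (fun hx' => hx ⟨by linarith [hx'.1], by linarith [hx'.2]⟩), zero_mul, zero_mul]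
      rwa [e] at h1
    have hPle := mul_le_mul_of_nonneg_left (le_abs_self P) (by positivity : 0 ≤ 2 * lam)
    rcases hQ0.eq_or_lt with hq | hq
    · have hP0 : P = 0 := by
        have h0 := (integral_eq_zero_iff_of_nonneg (fun x => sq_nonneg _) k2.integrable_sq).1 hq.symm
        rw [← hadj, ← integral_zero ℝ ℝ (μ := volume)]
        refine integral_congr_ae ?_
        filter_upwards [h0] with x hx
        have : conv φ h x = 0 := by simpa using hx
        rw [this, zero_mul]
      rw [← hq, hP0]
      linarith
    · have := mul_pos hlam hq
      linarith

end
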